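/- Let G be a connected finite simple graph that is even-hole-free and claw-free, with vertex weights b_v ∈ ℝ∖{0}, let K_s be a simplicial clique of G, and let G_χ be the extended graph obtained by adding a new vertex χ adjacent exactly to the vertices of K_s. Then for all real numbers u and v: (u+v) · Σ_{L} (−uv)^{|L|−1} · P_{C_L}(u²) · P_{C_L}(v²) · ∏_{w∈L, w≠χ} b_w² = v · P_{G∖K_s}(v²) · P_G(u²) + u · P_{G∖K_s}(u²) · P_G(v²), where the sum runs over all induced paths L in G_χ whose first vertex is χ (including the one-vertex path (χ)). -/

import Mathlib

/-- A graph is claw-free if it contains no induced `K_{1,3}`. -/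
def ClawFree {V : Type*} (G : SimpleGraph V) : Prop :=
  ¬ ∃ c a b d : V, a ≠ b ∧ a ≠ d ∧ b ≠ d ∧
    G.Adj c a ∧ G.Adj c b ∧ G.Adj c d ∧
    ¬ G.Adj a b ∧ ¬ G.Adj a d ∧ ¬ G.Adj b d

/-- `ℓ 0, ℓ 1, …, ℓ (m-1)` is an induced path in `G`. -/
def IsInducedPath {V : Type*} (G : SimpleGraph V) (m : ℕ) (ℓ : ℕ → V) : Prop :=
  (∀ a b, a < m → b < m → ℓ a = ℓ b → a = b) ∧
  ∀ a b, a < m → b < m → (G.Adj (ℓ a) (ℓ b) ↔ (a + 1 = b ∨ b + 1 = a))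

/-- `c 0, c 1, …, c (q-1)` is an induced cycle in `G`. -/
def IsInducedCycle {V : Type*} (G : SimpleGraph V) (q : ℕ) (c : ℕ → V) : Prop :=
  3 ≤ q ∧
  (∀ a b, a < q → b < q → c a = c b → a = b) ∧
  ∀ a b, a < q → b < q → (G.Adj (c a) (c b) ↔ ((a + 1) % q = b ∨ (b + 1) % q = a))

/-- A graph is even-hole-free if it contains no even induced cycle. -/
def EvenHoleFree {V : Type*} (G : SimpleGraph V) : Prop :=
  ¬ ∃ (q : ℕ) (c : ℕ → V), Even q ∧ IsInducedCycle G q c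

/-- A finset of vertices is a clique. -/
def IsClique {V : Type*} (G : SimpleGraph V) (K : Finset V) : Prop :=
  ∀ u ∈ K, ∀ v ∈ K, u ≠ v → G.Adj u v

/-- A clique `K` is simplicial if for every `v ∈ K` the set `Γ[v] ∖ K` is a clique. -/
def IsSimplicialClique {V : Type*} (G : SimpleGraph V) (K : Finset V) : Prop :=
  IsClique G K ∧
  ∀ v ∈ K, ∀ u u' : V, (u = v ∨ G.Adj u v) → u ∉ K → (u' = v ∨ G.Adj u' v) → u' ∉ K →
    u ≠ u' → G.Adj u u'

/-- The extended graph `G_χ`: a new vertex `χ` (represented by `none`) is adjacent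
exactly to the vertices of `K`. -/
def extGraph {V : Type*} (G : SimpleGraph V) (K : Finset V) : SimpleGraph (Option V) :=
  SimpleGraph.fromRel (fun x y =>
    (∃ u v : V, x = some u ∧ y = some v ∧ G.Adj u v) ∨
    (∃ v : V, x = none ∧ y = some v ∧ v ∈ K))

/-- The list `l = [ℓ₁, …, ℓ_n]` encodes the rooted path `χ – ℓ₁ – ⋯ – ℓ_n`:
this predicate says that this sequence is an induced path in the extended graph. -/
def IsRootedPath {V : Type*} (G : SimpleGraph V) (K : Finset V) (l : List V) : Prop :=
  IsInducedPath (extGraph G K) (l.length + 1)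
    (fun a => (none :: l.map some).getD a none)

/-- The residual graph of a rooted path: the vertices of `G` outside `K` (the closed
neighborhood of `χ` in `G`) and outside the closed neighborhood of every path vertex. -/
def residualSet {V : Type*} [Fintype V] [DecidableEq V] (G : SimpleGraph V)
    [DecidableRel G.Adj] (K : Finset V) (l : List V) : Finset V :=
  Finset.univ.filter (fun x => x ∉ K ∧ ∀ w ∈ l, ¬ (x = w ∨ G.Adj x w))

/-- The weighted independence polynomial of the induced subgraph of `G` on `A`. -/
noncomputable def indepPoly {V : Type*} [DecidableEq V] (G : SimpleGraph V)
    [DecidableRel G.Adj] (b : V → ℝ) (A : Finset V) (x : ℝ) : ℝ :=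
  ∑ S ∈ A.powerset.filter (fun S => ∀ u ∈ S, ∀ v ∈ S, u ≠ v → ¬ G.Adj u v),
    (-x) ^ S.card * ∏ v ∈ S, (b v) ^ 2

/-- Deleting a vertex: an independent set either avoids `k` or consists of `k` together with an
independent set outside the closed neighborhood of `k`. -/
theorem indepPoly_insert {V : Type*} [DecidableEq V] (G : SimpleGraph V)
    [DecidableRel G.Adj] (b : V → ℝ) (A : Finset V) (k : V) (hk : k ∉ A) (x : ℝ) :
    indepPoly G b (insert k A) x
      = indepPoly G b A x - x * (b k ^ 2 * indepPoly G b (A.filter fun y => ¬ G.Adj k y) x) := by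
  unfold indepPoly
  rw [Finset.sum_filter, Finset.sum_powerset_insert hk, ← Finset.sum_filter, sub_eq_add_neg]
  congr 1
  rw [← Finset.sum_filter, Finset.mul_sum, Finset.mul_sum, ← Finset.sum_neg_distrib]
  refine Finset.sum_congr ?_ ?_
  · ext S
    simp only [Finset.mem_filter, Finset.mem_powerset, Finset.subset_iff, Finset.mem_insert]
    constructor
    · rintro ⟨hS, hI⟩
      refine ⟨fun y hy => ⟨hS hy, hI k (Or.inl rfl) y (Or.inr hy) ?_⟩,
        fun p hp q hq => hI p (Or.inr hp) q (Or.inr hq)⟩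
      rintro rfl
      exact hk (hS hy)
    · rintro ⟨hS, hI⟩
      refine ⟨fun y hy => (hS hy).1, ?_⟩
      rintro p (rfl | hp) q (rfl | hq) hne
      · exact absurd rfl hne
      · exact (hS hq).2
      · exact fun h => (hS hp).2 h.symm
      · exact hI p hp q hq hne
  · intro S hS
    simp only [Finset.mem_filter, Finset.mem_powerset] at hS
    have hkS : k ∉ S := fun h => hk (Finset.mem_filter.mp (hS.1 h)).1
    rw [Finset.card_insert_of_notMem hkS, Finset.prod_insert hkS]
    ring

/-- Deleting a clique: an independent set contains at most one of its vertices. -/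
theorem indepPoly_sdiff_clique {V : Type*} [DecidableEq V] (G : SimpleGraph V)
    [DecidableRel G.Adj] (b : V → ℝ) (x : ℝ) (K : Finset V) :
    ∀ A : Finset V, K ⊆ A → IsClique G K →
      indepPoly G b A x = indepPoly G b (A \ K) x
        - x * ∑ k ∈ K, b k ^ 2 * indepPoly G b (A.filter fun y => y ≠ k ∧ ¬ G.Adj k y) x := by
  induction K using Finset.induction_on with
  | empty => simp
  | insert k K hk ih =>
    intro A hA hK
    have hkA : k ∈ A := hA (Finset.mem_insert_self k K)
    have hKA : K ⊆ A.erase k := fun y hy =>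
      Finset.mem_erase.mpr ⟨fun h => hk (h ▸ hy), hA (Finset.mem_insert_of_mem hy)⟩
    have hK' : IsClique G K := fun p hp q hq =>
      hK p (Finset.mem_insert_of_mem hp) q (Finset.mem_insert_of_mem hq)
    have h1 := indepPoly_insert G b (A.erase k) k (Finset.notMem_erase k A) x
    rw [Finset.insert_erase hkA, ih _ hKA hK'] at h1
    have e1 : A.erase k \ K = A \ insert k K := by
      ext y
      simp only [Finset.mem_sdiff, Finset.mem_erase, Finset.mem_insert]
      tauto
    have e2 : (A.erase k).filter (fun y => ¬ G.Adj k y)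
        = A.filter fun y => y ≠ k ∧ ¬ G.Adj k y := by
      ext y
      simp only [Finset.mem_filter, Finset.mem_erase]
      tauto
    have e3 : ∀ j ∈ K, (A.erase k).filter (fun y => y ≠ j ∧ ¬ G.Adj j y)
        = A.filter fun y => y ≠ j ∧ ¬ G.Adj j y := by
      intro j hj
      have hjk : G.Adj j k := hK j (Finset.mem_insert_of_mem hj) k (Finset.mem_insert_self k K)
        (fun h => hk (h ▸ hj))
      ext y
      simp only [Finset.mem_filter, Finset.mem_erase]
      refine ⟨fun h => ⟨h.1.2, h.2⟩, fun h => ⟨⟨?_, h.1⟩, h.2⟩⟩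
      rintro rfl
      exact h.2.2 hjk
    rw [e1, e2, Finset.sum_congr rfl (fun j hj => by rw [e3 j hj])] at h1
    rw [h1, Finset.sum_insert hk]
    ring

/-- `l` is an induced path inside `A` whose first vertex is its only vertex in `K`. -/
def IsPathFrom {V : Type*} (G : SimpleGraph V) (A K : Finset V) (l : List V) : Prop :=
  (∀ i x, l[i]? = some x → x ∈ A ∧ (x ∈ K ↔ i = 0)) ∧
  ∀ i j x y, l[i]? = some x → l[j]? = some y →
    (x = y → i = j) ∧ (G.Adj x y ↔ (i + 1 = j ∨ j + 1 = i))

theorem isPathFrom_nil {V : Type*} (G : SimpleGraph V) (A K : Finset V) :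
    IsPathFrom G A K [] := by
  simp [IsPathFrom]

theorem isPathFrom_cons {V : Type*} [DecidableEq V] (G : SimpleGraph V) [DecidableRel G.Adj]
    (A K : Finset V) (hKA : K ⊆ A) (k : V) (l : List V) :
    IsPathFrom G A K (k :: l) ↔
      k ∈ K ∧ IsPathFrom G (A \ K) ((A \ K).filter fun y => G.Adj k y) l := by
  constructor
  · rintro ⟨h1, h2⟩
    refine ⟨(h1 0 k rfl).2.mpr rfl, fun i x hx => ?_, fun i j x y hx hy => ?_⟩
    · have hxA := h1 (i + 1) x (by simpa using hx)
      have hadj := (h2 0 (i + 1) k x rfl (by simpa using hx)).2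
      have hxK : x ∉ K := fun h => by simpa using hxA.2.mp h
      refine ⟨Finset.mem_sdiff.mpr ⟨hxA.1, hxK⟩, ?_⟩
      simp only [Finset.mem_filter, Finset.mem_sdiff, hxA.1, hxK, hadj]
      simp
    · have h := h2 (i + 1) (j + 1) x y (by simpa using hx) (by simpa using hy)
      exact ⟨fun e => by have := h.1 e; omega, h.2.trans (by omega)⟩
  · rintro ⟨hk, h1, h2⟩
    refine ⟨fun i x hx => ?_, fun i j x y hx hy => ?_⟩
    · rcases i with _ | i
      · obtain rfl : k = x := by simpa using hx
        exact ⟨hKA hk, by simpa using hk⟩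
      · have h := Finset.mem_sdiff.mp (h1 i x (by simpa using hx)).1
        exact ⟨h.1, by simpa using h.2⟩
    · have key : ∀ j y, l[j]? = some y → k ≠ y ∧ (G.Adj k y ↔ j = 0) := by
        intro j y hy
        obtain ⟨hyA, hyN⟩ := h1 j y hy
        refine ⟨?_, by simpa [Finset.mem_filter, hyA] using hyN⟩
        rintro rfl
        exact (Finset.mem_sdiff.mp hyA).2 hk
      rcases i with _ | i <;> rcases j with _ | j
      · obtain rfl : k = x := by simpa using hx
        obtain rfl : k = y := by simpa using hy
        simp
      · obtain rfl : k = x := by simpa using hx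
        obtain ⟨hne, ha⟩ := key j y (by simpa using hy)
        exact ⟨fun e => absurd e hne, ha.trans (by omega)⟩
      · obtain rfl : k = y := by simpa using hy
        obtain ⟨hne, ha⟩ := key i x (by simpa using hx)
        exact ⟨fun e => absurd e.symm hne, (G.adj_comm x k).trans (ha.trans (by omega))⟩
      · have h := h2 i j x y (by simpa using hx) (by simpa using hy)
        exact ⟨fun e => by rw [h.1 e], h.2.trans (by omega)⟩

theorem isRootedPath_iff_isPathFrom {V : Type*} [Fintype V] (G : SimpleGraph V)
    (K : Finset V) (l : List V) :
    IsRootedPath G K l ↔ IsPathFrom G Finset.univ K l := by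
  have hss : ∀ x y : V, (extGraph G K).Adj (some x) (some y) ↔ G.Adj x y := by
    intro x y
    simp only [extGraph, SimpleGraph.fromRel_adj]
    constructor
    · rintro ⟨-, h⟩
      simpa [G.adj_comm y x] using h
    · intro h
      simpa [G.adj_comm y x, h] using h.ne
  have hns : ∀ x : V, (extGraph G K).Adj none (some x) ↔ x ∈ K := by
    intro x
    simp [extGraph, SimpleGraph.fromRel_adj]
  have hget : ∀ i x, l[i]? = some x → (l.map some).getD i none = some x := by
    intro i x h
    simp [List.getD, h]
  have hlt : ∀ i x, l[i]? = some x → i < l.length := fun i x h =>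
    (List.getElem?_eq_some_iff.mp h).1
  constructor
  · rintro ⟨h1, h2⟩
    refine ⟨fun i x hx => ⟨Finset.mem_univ x, ?_⟩, fun i j x y hx hy => ⟨fun e => ?_, ?_⟩⟩
    · have h := h2 0 (i + 1) (by omega) (by have := hlt i x hx; omega)
      simp only [List.getD_cons_zero, List.getD_cons_succ, hget i x hx, hns] at h
      exact h.trans (by omega)
    · have h := h1 (i + 1) (j + 1) (by have := hlt i x hx; omega) (by have := hlt j y hy; omega)
      simp only [List.getD_cons_succ, hget i x hx, hget j y hy, e] at h
      simpa using h
    · have h := h2 (i + 1) (j + 1) (by have := hlt i x hx; omega) (by have := hlt j y hy; omega)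
      simp only [List.getD_cons_succ, hget i x hx, hget j y hy, hss] at h
      exact h.trans (by omega)
  · rintro ⟨h1, h2⟩
    have hex : ∀ i, i + 1 < l.length + 1 → ∃ x, l[i]? = some x := fun i hi =>
      ⟨l[i], List.getElem?_eq_getElem (by omega)⟩
    refine ⟨fun i j hi hj => ?_, fun i j hi hj => ?_⟩
    · rcases i with _ | i <;> rcases j with _ | j
      · simp
      · obtain ⟨y, hy⟩ := hex j hj
        simp only [List.getD_cons_zero, List.getD_cons_succ, hget j y hy]
        simp
      · obtain ⟨x, hx⟩ := hex i hi
        simp only [List.getD_cons_zero, List.getD_cons_succ, hget i x hx]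
        simp
      · obtain ⟨x, hx⟩ := hex i hi
        obtain ⟨y, hy⟩ := hex j hj
        simp only [List.getD_cons_succ, hget i x hx, hget j y hy, Option.some.injEq]
        exact fun e => by rw [(h2 i j x y hx hy).1 e]
    · rcases i with _ | i <;> rcases j with _ | j
      · simp
      · obtain ⟨y, hy⟩ := hex j hj
        simp only [List.getD_cons_zero, List.getD_cons_succ, hget j y hy, hns]
        exact (h1 j y hy).2.trans (by omega)
      · obtain ⟨x, hx⟩ := hex i hi
        simp only [List.getD_cons_zero, List.getD_cons_succ, hget i x hx]
        rw [SimpleGraph.adj_comm, hns]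
        exact (h1 i x hx).2.trans (by omega)
      · obtain ⟨x, hx⟩ := hex i hi
        obtain ⟨y, hy⟩ := hex j hj
        simp only [List.getD_cons_succ, hget i x hx, hget j y hy, hss]
        exact (h2 i j x y hx hy).2.trans (by omega)

/-- The finset of induced paths with at most `n` vertices inside `A` that start in `K` and
afterwards avoid it. -/
def pathsFrom {V : Type*} [DecidableEq V] (G : SimpleGraph V) [DecidableRel G.Adj] :
    ℕ → Finset V → Finset V → Finset (List V)
  | 0, _, _ => {[]}
  | n + 1, A, K => insert [] (K.biUnion fun k =>
      (pathsFrom G n (A \ K) ((A \ K).filter fun y => G.Adj k y)).image (List.cons k))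

theorem card_sdiff_le_of_mem {V : Type*} [DecidableEq V] {A K : Finset V} {n : ℕ} {k : V}
    (hA : A.card ≤ n + 1) (hKA : K ⊆ A) (hk : k ∈ K) : (A \ K).card ≤ n := by
  have h1 := Finset.card_sdiff_add_card_eq_card hKA
  have h2 : 0 < K.card := Finset.card_pos.mpr ⟨k, hk⟩
  omega

theorem mem_pathsFrom {V : Type*} [DecidableEq V] (G : SimpleGraph V) [DecidableRel G.Adj]
    (n : ℕ) : ∀ (A K : Finset V) (l : List V), A.card ≤ n → K ⊆ A →
      (l ∈ pathsFrom G n A K ↔ IsPathFrom G A K l) := by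
  induction n with
  | zero =>
    intro A K l hA hKA
    obtain rfl : A = ∅ := by simpa using hA
    rcases l with _ | ⟨k, l⟩
    · simp [pathsFrom, isPathFrom_nil]
    · rw [isPathFrom_cons G _ _ hKA, Finset.subset_empty.mp hKA]
      simp [pathsFrom]
  | succ n ih =>
    intro A K l hA hKA
    rcases l with _ | ⟨k, l⟩
    · simp [pathsFrom, isPathFrom_nil]
    · rw [isPathFrom_cons G _ _ hKA]
      simp only [pathsFrom, Finset.mem_insert, Finset.mem_biUnion, Finset.mem_image,
        List.cons.injEq, reduceCtorEq, false_or]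
      constructor
      · rintro ⟨k, hk, l, hl, rfl, rfl⟩
        exact ⟨hk, (ih _ _ _ (card_sdiff_le_of_mem hA hKA hk) (Finset.filter_subset _ _)).mp hl⟩
      · rintro ⟨hk, hl⟩
        exact ⟨k, hk, l, (ih _ _ _ (card_sdiff_le_of_mem hA hKA hk)
          (Finset.filter_subset _ _)).mpr hl, rfl, rfl⟩

/-- The contribution of a path `l` to the path sum of the induced subgraph on `A`. -/
noncomputable def pathTerm {V : Type*} [DecidableEq V] (G : SimpleGraph V)
    [DecidableRel G.Adj] (b : V → ℝ) (u v : ℝ) (A K : Finset V) (l : List V) : ℝ :=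
  (-(u * v)) ^ l.length *
    indepPoly G b (A.filter fun x => x ∉ K ∧ ∀ w ∈ l, ¬ (x = w ∨ G.Adj x w)) (u ^ 2) *
    indepPoly G b (A.filter fun x => x ∉ K ∧ ∀ w ∈ l, ¬ (x = w ∨ G.Adj x w)) (v ^ 2) *
    (l.map fun w => (b w) ^ 2).prod

theorem pathTerm_nil {V : Type*} [DecidableEq V] (G : SimpleGraph V)
    [DecidableRel G.Adj] (b : V → ℝ) (u v : ℝ) (A K : Finset V) :
    pathTerm G b u v A K []
      = indepPoly G b (A \ K) (u ^ 2) * indepPoly G b (A \ K) (v ^ 2) := by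
  have h : A.filter (fun x => x ∉ K ∧ ∀ w ∈ ([] : List V), ¬ (x = w ∨ G.Adj x w)) = A \ K := by
    ext x
    simp
  simp only [pathTerm, h]
  simp

theorem pathTerm_cons {V : Type*} [DecidableEq V] (G : SimpleGraph V)
    [DecidableRel G.Adj] (b : V → ℝ) (u v : ℝ) (A K : Finset V) (k : V) (hk : k ∈ K)
    (l : List V) :
    pathTerm G b u v A K (k :: l) = -(u * v) * b k ^ 2 *
      pathTerm G b u v (A \ K) ((A \ K).filter fun y => G.Adj k y) l := by
  have h : A.filter (fun x => x ∉ K ∧ ∀ w ∈ k :: l, ¬ (x = w ∨ G.Adj x w))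
      = (A \ K).filter fun x => x ∉ (A \ K).filter (fun y => G.Adj k y) ∧
          ∀ w ∈ l, ¬ (x = w ∨ G.Adj x w) := by
    ext x
    have hne : x ∉ K → x ≠ k := fun h e => h (e ▸ hk)
    simp only [Finset.mem_filter, Finset.mem_sdiff, List.forall_mem_cons, G.adj_comm x k]
    tauto
  simp only [pathTerm, h, List.length_cons, List.map_cons, List.prod_cons]
  ring

/-- The two-variable path identity on an induced subgraph, by recursion on the first vertex of
the path. -/
theorem sum_pathTerm {V : Type*} [DecidableEq V] (G : SimpleGraph V)
    [DecidableRel G.Adj] (hcf : ClawFree G) (b : V → ℝ) (u v : ℝ) (n : ℕ) :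
    ∀ A K : Finset V, A.card ≤ n → K ⊆ A → IsClique G K →
      (∀ k ∈ K, IsClique G ((A \ K).filter fun y => G.Adj k y)) →
      (u + v) * ∑ l ∈ pathsFrom G n A K, pathTerm G b u v A K l
        = v * indepPoly G b (A \ K) (v ^ 2) * indepPoly G b A (u ^ 2)
          + u * indepPoly G b (A \ K) (u ^ 2) * indepPoly G b A (v ^ 2) := by
  induction n with
  | zero =>
    intro A K hA hKA _ _
    obtain rfl : A = ∅ := by simpa using hA
    rw [pathsFrom, Finset.sum_singleton, pathTerm_nil, Finset.empty_sdiff]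
    ring
  | succ n ih =>
    intro A K hA hKA hK hN
    have hres : ∀ k ∈ K, A.filter (fun y => y ≠ k ∧ ¬ G.Adj k y)
        = (A \ K) \ (A \ K).filter fun y => G.Adj k y := by
      intro k hk
      ext y
      have h1 : y ∈ K → y ≠ k → G.Adj k y := fun hy hne => hK k hk y hy hne.symm
      have h2 : y ∉ K → y ≠ k := fun h e => h (e ▸ hk)
      simp only [Finset.mem_filter, Finset.mem_sdiff]
      tauto
    have hstep : ∀ k ∈ K,
        (u + v) * ∑ l ∈ pathsFrom G n (A \ K) ((A \ K).filter fun y => G.Adj k y),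
          pathTerm G b u v A K (k :: l)
        = -(u * v) * (v * indepPoly G b (A \ K) (u ^ 2) * (b k ^ 2 *
              indepPoly G b (A.filter fun y => y ≠ k ∧ ¬ G.Adj k y) (v ^ 2))
            + u * indepPoly G b (A \ K) (v ^ 2) * (b k ^ 2 *
              indepPoly G b (A.filter fun y => y ≠ k ∧ ¬ G.Adj k y) (u ^ 2))) := by
      intro k hk
      have h := ih (A \ K) ((A \ K).filter fun y => G.Adj k y)
        (card_sdiff_le_of_mem hA hKA hk) (Finset.filter_subset _ _) (hN k hk) (by
          intro w hw p hp q hq hpq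
          simp only [Finset.mem_filter, Finset.mem_sdiff] at hw hp hq
          by_contra hadj
          have hkp : k ≠ p := fun e => hp.1.1.2 (e ▸ hk)
          have hkq : k ≠ q := fun e => hq.1.1.2 (e ▸ hk)
          exact hcf ⟨w, k, p, q, hkp, hkq, hpq, hw.2.symm, hp.2, hq.2,
            fun e => hp.1.2 ⟨hp.1.1, e⟩, fun e => hq.1.2 ⟨hq.1.1, e⟩, hadj⟩)
      rw [← hres k hk] at h
      rw [Finset.sum_congr rfl fun l _ => pathTerm_cons G b u v A K k hk l, ← Finset.mul_sum]
      linear_combination (-(u * v) * b k ^ 2) * h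
    rw [pathsFrom, Finset.sum_insert (by simp), pathTerm_nil, Finset.sum_biUnion, mul_add,
      Finset.mul_sum, Finset.sum_congr rfl (fun k hk => by
        rw [Finset.sum_image (fun _ _ _ _ h => List.tail_eq_of_cons_eq h), hstep k hk]),
      ← Finset.mul_sum, Finset.sum_add_distrib, ← Finset.mul_sum, ← Finset.mul_sum,
      indepPoly_sdiff_clique G b (u ^ 2) K A hKA hK,
      indepPoly_sdiff_clique G b (v ^ 2) K A hKA hK]
    · ring
    · intro k _ j _ hkj
      refine Finset.disjoint_left.mpr fun l hl hl' => hkj ?_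
      obtain ⟨l₁, -, rfl⟩ := Finset.mem_image.mp hl
      obtain ⟨l₂, -, h⟩ := Finset.mem_image.mp hl'
      exact (List.head_eq_of_cons_eq h).symm

/-- The two-variable path-product identity for independence polynomials
(Corollary of the anticommutator identity for the Krylov generating function). -/
theorem stmt_9 {V : Type*} [Fintype V] [DecidableEq V] (G : SimpleGraph V)
    [DecidableRel G.Adj] (hconn : G.Connected)
    (hehf : EvenHoleFree G) (hcf : ClawFree G)
    (b : V → ℝ) (hb : ∀ w, b w ≠ 0)
    (K : Finset V) (hK : IsSimplicialClique G K)
    (u v : ℝ) :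
    (u + v) *
        ∑ᶠ l ∈ {l : List V | IsRootedPath G K l},
          (-(u * v)) ^ l.length *
            indepPoly G b (residualSet G K l) (u ^ 2) *
            indepPoly G b (residualSet G K l) (v ^ 2) *
            (l.map fun w => (b w) ^ 2).prod
      = v * indepPoly G b (Finset.univ \ K) (v ^ 2) * indepPoly G b Finset.univ (u ^ 2)
        + u * indepPoly G b (Finset.univ \ K) (u ^ 2) *
            indepPoly G b Finset.univ (v ^ 2) := by
  obtain ⟨n, hn⟩ : ∃ n, (Finset.univ : Finset V).card ≤ n := ⟨_, le_rfl⟩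
  have hset : {l : List V | IsRootedPath G K l} = ↑(pathsFrom G n Finset.univ K) := by
    ext l
    rw [Set.mem_ofPred_eq, Finset.mem_coe,
      mem_pathsFrom G n _ _ l hn (Finset.subset_univ K), isRootedPath_iff_isPathFrom]
  have hN : ∀ k ∈ K, IsClique G ((Finset.univ \ K).filter fun y => G.Adj k y) := by
    intro k hk p hp q hq hpq
    simp only [Finset.mem_filter, Finset.mem_sdiff] at hp hq
    exact hK.2 k hk p q (Or.inr hp.2.symm) hp.1.2 (Or.inr hq.2.symm) hq.1.2 hpq
  rw [hset, finsum_mem_coe_finset]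
  rw [← sum_pathTerm G hcf b u v n Finset.univ K hn (Finset.subset_univ K) hK.1 hN]
  refine congrArg ((u + v) * ·) (Finset.sum_congr rfl fun l _ => ?_)
  have hterm : ∀ A, residualSet G K l = A →
      (-(u * v)) ^ l.length * indepPoly G b (residualSet G K l) (u ^ 2) *
          indepPoly G b (residualSet G K l) (v ^ 2) * (l.map fun w => (b w) ^ 2).prod
        = (-(u * v)) ^ l.length * indepPoly G b A (u ^ 2) * indepPoly G b A (v ^ 2) *
          (l.map fun w => (b w) ^ 2).prod := by
    rintro A rfl
    rfl
  refine hterm _ ?_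
  ext x
  simp only [residualSet, Finset.mem_filter]
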